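/- arXiv:math/0606016 — 2 statements merged into one kernel-verified Lean document; each statement's English description precedes it below -/
import Mathlib

section
/- (Widom's lemma) Let A_n = (a_{j,k})_{j,k=0}^{n-1} be any n×n complex matrix and let G_n be the integral operator on L²(0,1) with kernel g_n(x,y) = a_{[nx],[ny]}, where [ξ] denotes the integer part. Then the spectral norm of A_n and the operator norm of G_n are related by ‖A_n‖ = n‖G_n‖. -/
open MeasureTheory Filter Asymptotics Real Set

noncomputable def specNorm {n : ℕ} (M : Matrix (Fin n) (Fin n) ℂ) : ℝ :=
  ‖Matrix.toEuclideanCLM (𝕜 := ℂ) (n := Fin n) M‖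

noncomputable def toeplitz (a : ℤ → ℂ) (n : ℕ) : Matrix (Fin n) (Fin n) ℂ :=
  Matrix.of fun j k => a ((j : ℤ) - (k : ℤ))

noncomputable abbrev μ01 : Measure ℝ := volume.restrict (Set.Ioo 0 1)

noncomputable abbrev L2I := Lp ℂ 2 μ01

def IsIntegralOp (k : ℝ → ℝ → ℂ) (K : L2I →L[ℂ] L2I) : Prop :=
  ∀ f : L2I, ∀ᵐ x ∂μ01, (K f : ℝ → ℂ) x = ∫ y in Set.Ioo (0:ℝ) 1, k x y * (f : ℝ → ℂ) y

noncomputable def fc (a : ℝ → ℂ) (k : ℤ) : ℂ :=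
  (1 / (2 * π)) * ∫ θ in (-π)..π, a θ * Complex.exp (-Complex.I * k * θ)

/-- The `k`-th cell of the uniform partition. -/
def cell (n k : ℕ) : Set ℝ := Set.Ico ((k : ℝ) / n) (((k : ℝ) + 1) / n)

lemma cell_meas (n k : ℕ) : MeasurableSet (cell n k) := measurableSet_Ico

lemma mem_cell {n : ℕ} (hn : 0 < n) (k : ℕ) {x : ℝ} (hx : 0 < x) :
    x ∈ cell n k ↔ ⌊(n : ℝ) * x⌋₊ = k := by
  have hn' : (0 : ℝ) < n := by exact_mod_cast hn
  rw [Nat.floor_eq_iff (by positivity), cell, Set.mem_Ico, div_le_iff₀ hn', lt_div_iff₀ hn',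
    mul_comm x]

lemma cell_measure {n : ℕ} (hn : 0 < n) (k : Fin n) : μ01.real (cell n k) = 1 / n := by
  have hn' : (0 : ℝ) < n := by exact_mod_cast hn
  have h1 : μ01 = volume.restrict (Set.Ico (0:ℝ) 1) :=
    Measure.restrict_congr_set Ioo_ae_eq_Ico
  have hk : ((k : ℕ) : ℝ) + 1 ≤ n := by exact_mod_cast k.2
  have h2 : cell n k ∩ Set.Ico (0:ℝ) 1 = cell n k := by
    apply Set.inter_eq_left.2
    apply Set.Ico_subset_Ico
    · positivity
    · rw [div_le_one hn']; exact hk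
  rw [h1, measureReal_restrict_apply (cell_meas n k), h2, cell, Real.volume_real_Ico_of_le]
  · ring
  · gcongr; linarith

/-- normalized indicator -/
noncomputable def ee (n k : ℕ) : L2I :=
  indicatorConstLp 2 (cell_meas n k) (measure_ne_top μ01 _) (1 : ℂ)

lemma ee_coe {n : ℕ} (hn : 0 < n) (k : ℕ) :
    ∀ᵐ x ∂μ01, (ee n k : ℝ → ℂ) x = if ⌊(n : ℝ) * x⌋₊ = k then 1 else 0 := by
  filter_upwards [indicatorConstLp_coeFn (p := 2) (hs := cell_meas n k)
    (hμs := measure_ne_top μ01 _) (c := (1 : ℂ)), ae_restrict_mem measurableSet_Ioo] with x hx hx0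
  rw [ee, hx]
  by_cases h : ⌊(n : ℝ) * x⌋₊ = k
  · rw [if_pos h, Set.indicator_of_mem ((mem_cell hn k hx0.1).2 h)]
  · rw [if_neg h, Set.indicator_of_notMem (fun h' => h ((mem_cell hn k hx0.1).1 h'))]

lemma inner_ee (n k : ℕ) (f : L2I) : inner ℂ (ee n k) f = ∫ x in cell n k, f x ∂μ01 :=
  L2.inner_indicatorConstLp_one _ _ _

lemma inner_ee_ee {n : ℕ} (hn : 0 < n) (j k : Fin n) :
    inner ℂ (ee n j) (ee n k) = if j = k then (1 / n : ℂ) else 0 := by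
  have h : ∀ᵐ x ∂(μ01.restrict (cell n j)),
      (ee n k : ℝ → ℂ) x = if j = k then 1 else 0 := by
    filter_upwards [ae_restrict_of_ae (ee_coe hn k), ae_restrict_mem (cell_meas n j),
      ae_restrict_of_ae (ae_restrict_mem measurableSet_Ioo)] with x hx hxc hx0
    rw [hx, (mem_cell hn j hx0.1).1 hxc]
    simp [Fin.ext_iff]
  rw [inner_ee, integral_congr_ae h, setIntegral_const, cell_measure hn]
  split_ifs <;> simp

lemma ortho {n : ℕ} (hn : 0 < n) :
    Orthonormal ℂ (fun k : Fin n => ((√n : ℝ) : ℂ) • ee n k) := by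
  rw [orthonormal_iff_ite]
  intro j k
  have h : ((√n : ℝ) : ℂ) * ((√n : ℝ) : ℂ) = n := by
    rw [← Complex.ofReal_mul, Real.mul_self_sqrt (by positivity)]; simp
  have hn' : (n : ℂ) ≠ 0 := by exact_mod_cast hn.ne'
  rw [inner_smul_left, inner_smul_right, inner_ee_ee hn, Complex.conj_ofReal, ← mul_assoc, h]
  split_ifs <;> simp [hn']

lemma G_eq {n : ℕ} (hn : 0 < n) (a : ℕ → ℕ → ℂ) (G : L2I →L[ℂ] L2I)
    (hG : IsIntegralOp (fun x y => a ⌊(n : ℝ) * x⌋₊ ⌊(n : ℝ) * y⌋₊) G) (f : L2I) :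
    G f = ∑ j : Fin n, (∑ k : Fin n, a j k * inner ℂ (ee n k) f) • ee n j := by
  have hfl : ∀ x ∈ Set.Ioo (0:ℝ) 1, ⌊(n : ℝ) * x⌋₊ < n := by
    intro x hx
    have hn' : (0 : ℝ) < n := by exact_mod_cast hn
    rw [Nat.floor_lt (mul_nonneg hn'.le hx.1.le)]
    nlinarith [hx.2]
  have hf : Integrable (f : ℝ → ℂ) μ01 := (Lp.memLp f).integrable (by norm_num)
  apply Lp.ext
  have hs := Lp.coeFn_finsetSum (Finset.univ : Finset (Fin n))
    (fun j => (∑ k : Fin n, a j k * inner ℂ (ee n k) f) • ee n j)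
  have hsm : ∀ᵐ x ∂μ01, ∀ j : Fin n,
      (((∑ k : Fin n, a j k * inner ℂ (ee n k) f) • ee n j : L2I) : ℝ → ℂ) x
        = (∑ k : Fin n, a j k * inner ℂ (ee n k) f) * (ee n j : ℝ → ℂ) x := by
    rw [ae_all_iff]; intro j
    filter_upwards [Lp.coeFn_smul (∑ k : Fin n, a j k * inner ℂ (ee n k) f) (ee n j)] with x hx
    rw [hx]; rfl
  have he : ∀ᵐ x ∂μ01, ∀ j : Fin n,
      (ee n j : ℝ → ℂ) x = if ⌊(n : ℝ) * x⌋₊ = j then 1 else 0 := by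
    rw [ae_all_iff]; intro j; exact ee_coe hn j
  filter_upwards [hG f, hs, hsm, he, ae_restrict_mem measurableSet_Ioo] with x h1 h2 h3 h4 hx
  rw [h1, h2]
  simp only [Finset.sum_apply, h3, h4]
  rw [Finset.sum_eq_single (⟨_, hfl x hx⟩ : Fin n)]
  · simp only [if_true, mul_one]
    have : ∀ y ∈ Set.Ioo (0:ℝ) 1, a ⌊(n : ℝ) * x⌋₊ ⌊(n : ℝ) * y⌋₊ * (f : ℝ → ℂ) y
        = ∑ k : Fin n, a ⌊(n : ℝ) * x⌋₊ k * (cell n k).indicator (f : ℝ → ℂ) y := by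
      intro y hy
      rw [Finset.sum_eq_single (⟨_, hfl y hy⟩ : Fin n)]
      · rw [Set.indicator_of_mem ((mem_cell hn _ hy.1).2 rfl)]
      · intro b _ hb
        rw [Set.indicator_of_notMem, mul_zero]
        intro h; exact hb (Fin.ext ((mem_cell hn _ hy.1).1 h).symm)
      · simp
    rw [setIntegral_congr_fun measurableSet_Ioo this, integral_finsetSum]
    · refine Finset.sum_congr rfl fun k _ => ?_
      rw [integral_const_mul, integral_indicator (cell_meas n k), inner_ee]
    · intro k _
      exact (hf.indicator (cell_meas n k)).const_mul _
  · intro b _ hb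
    rw [if_neg, mul_zero]
    intro h; exact hb (Fin.ext h.symm)
  · simp

open ContinuousLinearMap in
theorem stmt4 (n : ℕ) (hn : 0 < n) (a : ℕ → ℕ → ℂ) (G : L2I →L[ℂ] L2I)
    (hG : IsIntegralOp (fun x y => a ⌊(n : ℝ) * x⌋₊ ⌊(n : ℝ) * y⌋₊) G) :
    specNorm (Matrix.of fun j k : Fin n => a j k) = n * ‖G‖ := by
  set b := EuclideanSpace.basisFun (Fin n) ℂ with hb
  set u : Fin n → L2I := fun k => ((√n : ℝ) : ℂ) • ee n k with hu
  have hcu : (b.toBasis.constr ℂ u) ∘ b.toBasis = u := by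
    funext k; simp only [Function.comp, Module.Basis.constr_basis]
  let U0 : EuclideanSpace ℂ (Fin n) →ₗᵢ[ℂ] L2I :=
    (b.toBasis.constr ℂ u).isometryOfOrthonormal (v := b.toBasis)
      (by simpa using b.orthonormal) (by rw [hcu]; exact ortho hn)
  let U := U0.toContinuousLinearMap
  have hUv : ∀ v, U v = ∑ j, v j • u j := by
    intro v
    change b.toBasis.constr ℂ u v = _
    rw [Module.Basis.constr_apply_fintype]
    simp [hb]
  have hUs : ∀ f k, (adjoint U f) k = inner ℂ (u k) f := by
    intro f k
    have : (adjoint U f) k = inner ℂ (b k) (adjoint U f) := by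
      simp [hb, EuclideanSpace.inner_single_left]
    rw [this, adjoint_inner_right]
    congr 1
    change b.toBasis.constr ℂ u (b k) = _
    rw [← b.coe_toBasis, Module.Basis.constr_basis]
  set M := Matrix.of fun j k : Fin n => a j k with hM
  set A := Matrix.toEuclideanCLM (𝕜 := ℂ) (n := Fin n) M with hA
  have hsq : ((√n : ℝ) : ℂ) * ((√n : ℝ) : ℂ) = n := by
    rw [← Complex.ofReal_mul, Real.mul_self_sqrt (by positivity)]; simp
  have key : (n : ℂ) • G = U ∘L A ∘L adjoint U := by
    ext1 f
    rw [_root_.smul_apply, G_eq hn a G hG f, comp_apply, comp_apply, hUv,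
      Finset.smul_sum]
    refine Finset.sum_congr rfl fun j _ => ?_
    have : (A (adjoint U f)) j = ∑ k : Fin n, a j k * inner ℂ (u k) f := by
      change (M.mulVec (adjoint U f).ofLp) j = _
      simp [Matrix.mulVec, dotProduct, hM, hUs]
    rw [this, hu]
    simp only [inner_smul_left, Complex.conj_ofReal, smul_smul]
    congr 1
    rw [← hsq, Finset.mul_sum, Finset.sum_mul]
    exact Finset.sum_congr rfl fun k _ => by ring
  have hUU : adjoint U ∘L U = ContinuousLinearMap.id ℂ _ := by
    exact (norm_map_iff_adjoint_comp_self U).1 U0.norm_map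
  have key2 : A = adjoint U ∘L ((n : ℂ) • G) ∘L U := by
    rw [key]
    ext1 v
    have h := fun w => DFunLike.congr_fun hUU w
    simp only [comp_apply, ContinuousLinearMap.id_apply] at h
    simp only [comp_apply, h]
  have hU1 : ‖U‖ ≤ 1 := U0.norm_toContinuousLinearMap_le
  have hU2 : ‖adjoint U‖ ≤ 1 := by rw [LinearIsometryEquiv.norm_map]; exact hU1
  have hnG : ‖(n : ℂ) • G‖ = n * ‖G‖ := by rw [norm_smul]; simp
  rw [specNorm, ← hnG]
  apply le_antisymm
  · rw [← hA, key2]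
    refine (opNorm_comp_le _ _).trans ?_
    refine (mul_le_of_le_one_left (norm_nonneg _) hU2).trans ?_
    exact (opNorm_comp_le _ _).trans (mul_le_of_le_one_right (norm_nonneg _) hU1)
  · rw [key]
    refine (opNorm_comp_le _ _).trans ?_
    refine (mul_le_of_le_one_left (norm_nonneg _) hU1).trans ?_
    exact (opNorm_comp_le _ _).trans (mul_le_of_le_one_right (norm_nonneg _) hU2)
end

section
/- Let γ ∈ ℂ with Re γ > -1 and C⁺, C⁻ ∈ ℂ, and define a_{±m} = C^{±} m^γ for m ≥ 1 with a_0 arbitrary. Let K_n be the integral operator on L²(0,1) with kernel n^{-γ} a_{[nx]-[ny]}, and let K be the integral operator with kernel C⁺(x-y)^γ for x > y and C⁻(y-x)^γ for x < y. Then K_n converges to K in operator norm on L²(0,1) as n → ∞. -/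
open MeasureTheory Filter Asymptotics Real Set

open scoped ENNReal Topology

/-- The difference kernel. -/
noncomputable def kap (Cp Cm γ : ℂ) (s : ℝ) : ℂ :=
  if 0 < s then Cp * ((s : ℝ) : ℂ) ^ γ else if s < 0 then Cm * ((-s : ℝ) : ℂ) ^ γ else 0

lemma kap_measurable (Cp Cm γ : ℂ) : Measurable (kap Cp Cm γ) := by
  unfold kap
  refine Measurable.ite measurableSet_Ioi ?_ (Measurable.ite measurableSet_Iio ?_ ?_)
  · exact measurable_const.mul (Complex.measurable_ofReal.pow_const γ)
  · exact measurable_const.mul ((Complex.measurable_ofReal.comp measurable_neg).pow_const γ)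
  · exact measurable_const

lemma kap_norm (Cp Cm γ : ℂ) (s : ℝ) (hs : s ≠ 0) :
    ‖kap Cp Cm γ s‖ ≤ (‖Cp‖ + ‖Cm‖) * |s| ^ γ.re := by
  unfold kap
  rcases lt_or_gt_of_ne hs with h | h
  · rw [if_neg (not_lt.2 h.le), if_pos h, norm_mul,
      Complex.norm_cpow_eq_rpow_re_of_pos (by linarith), abs_of_neg h]
    have : 0 ≤ (-s) ^ γ.re := Real.rpow_nonneg (by linarith) _
    nlinarith [norm_nonneg Cp, norm_nonneg Cm]
  · rw [if_pos h, norm_mul,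
      Complex.norm_cpow_eq_rpow_re_of_pos h, abs_of_pos h]
    have : 0 ≤ (s) ^ γ.re := Real.rpow_nonneg (by linarith) _
    nlinarith [norm_nonneg Cp, norm_nonneg Cm]

lemma kap_cont (Cp Cm γ : ℂ) (s : ℝ) (hs : s ≠ 0) : ContinuousAt (kap Cp Cm γ) s := by
  rcases lt_or_gt_of_ne hs with h | h
  · have h1 : (fun s : ℝ => Cm * ((-s : ℝ) : ℂ) ^ γ) =ᶠ[𝓝 s] kap Cp Cm γ := by
      filter_upwards [Iio_mem_nhds h] with t ht
      have ht : t < 0 := ht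
      simp [kap, ht, not_lt.2 ht.le]
    refine ContinuousAt.congr ?_ h1
    refine continuousAt_const.mul ?_
    have := Complex.continuousAt_ofReal_cpow_const (-s) γ (Or.inr (by linarith))
    exact ContinuousAt.comp (f := fun s : ℝ => -s) (g := fun t : ℝ => (t : ℂ) ^ γ) this
      continuousAt_neg
  · have h1 : (fun s : ℝ => Cp * ((s : ℝ) : ℂ) ^ γ) =ᶠ[𝓝 s] kap Cp Cm γ := by
      filter_upwards [Ioi_mem_nhds h] with t ht
      have ht : 0 < t := ht
      simp [kap, ht]
    refine ContinuousAt.congr ?_ h1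
    exact continuousAt_const.mul (Complex.continuousAt_ofReal_cpow_const s γ (Or.inr (by linarith)))

lemma nat_div_cpow (γ : ℂ) (m n : ℕ) :
    (((m : ℝ) / (n : ℝ) : ℝ) : ℂ) ^ γ = (n : ℂ) ^ (-γ) * (m : ℂ) ^ γ := by
  rw [div_eq_mul_inv, Complex.ofReal_mul,
    Complex.mul_cpow_ofReal_nonneg (by positivity) (by positivity), mul_comm]
  congr 1
  · rw [Complex.ofReal_inv, Complex.inv_cpow _ _ ?_, Complex.cpow_neg]
    · simp
    · rw [Complex.arg_ofReal_of_nonneg (by positivity)]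
      exact Real.pi_pos.ne

lemma a_eq_kap (Cp Cm γ : ℂ) (a : ℤ → ℂ)
    (hap : ∀ m : ℕ, 1 ≤ m → a (m : ℤ) = Cp * (m : ℂ) ^ γ)
    (ham : ∀ m : ℕ, 1 ≤ m → a (-(m : ℤ)) = Cm * (m : ℂ) ^ γ)
    (n : ℕ) (hn : 1 ≤ n) (m : ℤ) (hm : m ≠ 0) :
    (n : ℂ) ^ (-γ) * a m = kap Cp Cm γ ((m : ℝ) / n) := by
  have hn0 : (0 : ℝ) < n := by exact_mod_cast hn
  obtain ⟨k, rfl | rfl⟩ := Int.eq_nat_or_neg m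
  · have hk : 1 ≤ k := by omega
    have hk0 : (0 : ℝ) < k := by exact_mod_cast hk
    rw [hap k hk, kap, if_pos (by push_cast; positivity)]
    rw [Int.cast_natCast, nat_div_cpow]
    ring
  · have hk : 1 ≤ k := by omega
    have hk0 : (0 : ℝ) < k := by exact_mod_cast hk
    have h0 : (((-(k : ℤ) : ℤ) : ℝ) / n) < 0 := by
      push_cast
      exact div_neg_of_neg_of_pos (by linarith) hn0
    rw [ham k hk, kap, if_neg (not_lt.2 h0.le), if_pos h0]
    have : -(((-(k : ℤ) : ℤ) : ℝ) / n) = (k : ℝ) / n := by push_cast; ring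
    rw [this, nat_div_cpow]
    ring

/-- Two-sided monotonicity bound for powers. -/
lemma rpow_two_bound (g u t : ℝ) (v : ℝ) (hu : 0 < u) (h1 : u ≤ t) (h2 : t ≤ v) :
    t ^ g ≤ u ^ g + v ^ g := by
  have hv : 0 < v := by linarith
  rcases le_total 0 g with hg | hg
  · have := Real.rpow_le_rpow (by linarith) h2 hg
    have := Real.rpow_nonneg hu.le g
    linarith
  · have := Real.rpow_le_rpow_of_nonpos hu h1 hg
    have := Real.rpow_nonneg hv.le g
    linarith

lemma dom_bound (Cp Cm γ : ℂ) (a : ℤ → ℂ)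
    (hap : ∀ m : ℕ, 1 ≤ m → a (m : ℤ) = Cp * (m : ℂ) ^ γ)
    (ham : ∀ m : ℕ, 1 ≤ m → a (-(m : ℤ)) = Cm * (m : ℂ) ^ γ)
    (n : ℕ) (hn : 1 ≤ n) (m : ℤ) (s : ℝ) (hs0 : s ≠ 0) (hs : |s| < 1)
    (hm : |(m : ℝ) - n * s| < 1) :
    ‖(n : ℂ) ^ (-γ) * a m - kap Cp Cm γ s‖ ≤
      (‖Cp‖ + ‖Cm‖) * ((|s| / 2) ^ γ.re + 2 ^ γ.re) + ‖a 0‖ * (|s| ^ γ.re + 1 ^ γ.re)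
        + (‖Cp‖ + ‖Cm‖) * |s| ^ γ.re := by
  have hn0 : (0 : ℝ) < n := by exact_mod_cast hn
  have hn1 : (1 : ℝ) ≤ n := by exact_mod_cast hn
  have hsp : 0 < |s| := abs_pos.2 hs0
  refine (norm_sub_le _ _).trans (add_le_add ?_ (kap_norm Cp Cm γ s hs0))
  have hns : |(n : ℝ) * s| = n * |s| := by rw [abs_mul, abs_of_pos hn0]
  have p1 : 0 ≤ ‖a 0‖ * (|s| ^ γ.re + 1 ^ γ.re) := by positivity
  have p2 : 0 ≤ (‖Cp‖ + ‖Cm‖) * ((|s| / 2) ^ γ.re + 2 ^ γ.re) := by positivity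
  by_cases h : m = 0
  · subst h
    have hlt : n * |s| < 1 := by
      rw [← hns]; simpa using hm
    refine le_trans ?_ (le_add_of_nonneg_left p2)
    rw [norm_mul, mul_comm]
    refine mul_le_mul_of_nonneg_left ?_ (norm_nonneg _)
    have e : ‖(n : ℂ) ^ (-γ)‖ = ((n : ℝ)⁻¹) ^ γ.re := by
      rw [Complex.norm_natCast_cpow_of_pos (by omega), Complex.neg_re, Real.rpow_neg hn0.le,
        Real.inv_rpow hn0.le]
    rw [e]
    refine rpow_two_bound _ _ _ _ hsp ?_ ?_
    · rw [le_inv_comm₀ hsp hn0, le_inv_comm₀ hn0 hsp, inv_eq_one_div, le_div_iff₀ hn0]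
      linarith
    · exact inv_le_one_of_one_le₀ hn1
  · refine le_trans ?_ (le_add_of_nonneg_right p1)
    rw [a_eq_kap Cp Cm γ a hap ham n hn m h]
    have hm0 : (m : ℝ) ≠ 0 := by exact_mod_cast h
    refine (kap_norm Cp Cm γ _ (div_ne_zero hm0 hn0.ne')).trans ?_
    refine mul_le_mul_of_nonneg_left ?_ (by positivity)
    have h1 : (1 : ℝ) ≤ |(m : ℝ)| := by exact_mod_cast Int.one_le_abs h
    have h2 := abs_sub_abs_le_abs_sub (m : ℝ) (n * s)
    have h3 := abs_sub_abs_le_abs_sub (n * s) (m : ℝ)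
    rw [abs_sub_comm] at h3
    rw [hns] at h2 h3
    rw [abs_div, abs_of_pos hn0]
    refine rpow_two_bound _ _ _ _ (by positivity) ?_ ?_
    · rw [le_div_iff₀ hn0]; nlinarith
    · rw [div_le_iff₀ hn0]; nlinarith

lemma integrable_abs_rpow (g : ℝ) (hg : -1 < g) :
    IntegrableOn (fun s : ℝ => |s| ^ g) (Ioo (-1) 1) := by
  have h1 : IntegrableOn (fun s : ℝ => |s| ^ g) (Ioc 0 1) := by
    have := (intervalIntegral.intervalIntegrable_rpow' (a := 0) (b := 1) hg).1
    refine this.congr_fun (fun x hx => ?_) measurableSet_Ioc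
    simp [abs_of_pos hx.1]
  have h2 : IntegrableOn (fun s : ℝ => |s| ^ g) (Ico (-1) 0) := by
    have := h1.comp_neg
    simpa using this
  have h3 : IntegrableOn (fun s : ℝ => |s| ^ g) {0} := by
    exact integrableOn_singleton (by simp) (by simp)
  refine ((h1.union h2).union h3).mono_set ?_
  intro x hx
  rcases lt_trichotomy x 0 with h | h | h
  · exact Or.inl (Or.inr ⟨hx.1.le, h⟩)
  · exact Or.inr h
  · exact Or.inl (Or.inl ⟨h, hx.2.le⟩)

lemma tendsto_aux (Cp Cm γ : ℂ) (hγ : -1 < γ.re) (a : ℤ → ℂ)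
    (hap : ∀ m : ℕ, 1 ≤ m → a (m : ℤ) = Cp * (m : ℂ) ^ γ)
    (ham : ∀ m : ℕ, 1 ≤ m → a (-(m : ℤ)) = Cm * (m : ℂ) ^ γ)
    (r : ℕ → ℝ → ℤ) (hr : ∀ n s, |(r n s : ℝ) - n * s| < 1) (hrm : ∀ n, Measurable (r n)) :
    Tendsto (fun n : ℕ => ∫⁻ s in Ioo (-1 : ℝ) 1, ‖(n : ℂ) ^ (-γ) * a (r n s) - kap Cp Cm γ s‖ₑ)
      atTop (𝓝 0) := by
  have hae : ∀ᵐ s ∂(volume.restrict (Ioo (-1 : ℝ) 1)), s ≠ 0 ∧ |s| < 1 := by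
    filter_upwards [ae_restrict_mem measurableSet_Ioo,
      ae_restrict_of_ae (Measure.ae_ne volume (0 : ℝ))] with s h1 h2
    exact ⟨h2, abs_lt.2 h1⟩
  have key := tendsto_lintegral_filter_of_dominated_convergence (l := atTop)
    (μ := volume.restrict (Ioo (-1 : ℝ) 1))
    (F := fun (n : ℕ) s => ‖(n : ℂ) ^ (-γ) * a (r n s) - kap Cp Cm γ s‖ₑ) (f := fun _ => 0)
    (bound := fun s => ENNReal.ofReal (
      (‖Cp‖ + ‖Cm‖) * ((|s| / 2) ^ γ.re + 2 ^ γ.re) + ‖a 0‖ * (|s| ^ γ.re + 1 ^ γ.re)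
        + (‖Cp‖ + ‖Cm‖) * |s| ^ γ.re)) ?_ ?_ ?_ ?_
  · simpa using key
  · refine Eventually.of_forall fun n => ?_
    exact ((measurable_const.mul ((measurable_from_top (f := a)).comp (hrm n))).sub
      (kap_measurable Cp Cm γ)).enorm
  · filter_upwards [eventually_ge_atTop 1] with n hn
    filter_upwards [hae] with s hs
    rw [← ofReal_norm]
    exact ENNReal.ofReal_le_ofReal
      (dom_bound Cp Cm γ a hap ham n hn _ s hs.1 hs.2 (hr n s))
  · have hi := integrable_abs_rpow γ.re hγ
    have hi2 : IntegrableOn (fun s : ℝ => (|s| / 2) ^ γ.re) (Ioo (-1) 1) := by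
      have : (fun s : ℝ => (|s| / 2) ^ γ.re) = fun s => |s| ^ γ.re / 2 ^ γ.re := by
        funext s
        rw [Real.div_rpow (abs_nonneg s) (by norm_num)]
      rw [this]
      exact Integrable.div_const hi _
    have hc : ∀ c : ℝ, IntegrableOn (fun s : ℝ => c) (Ioo (-1 : ℝ) 1) := fun c => by simp
    have : IntegrableOn (fun s : ℝ => (‖Cp‖ + ‖Cm‖) * ((|s| / 2) ^ γ.re + 2 ^ γ.re) +
        ‖a 0‖ * (|s| ^ γ.re + 1 ^ γ.re) + (‖Cp‖ + ‖Cm‖) * |s| ^ γ.re) (Ioo (-1) 1) :=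
      (((hi2.add (hc _)).const_mul _).add ((hi.add (hc _)).const_mul _)).add (hi.const_mul _)
    exact this.lintegral_lt_top.ne
  · filter_upwards [hae] with s hs
    have h1 : Tendsto (fun n : ℕ => (r n s : ℝ) / n) atTop (𝓝 s) := by
      rw [tendsto_iff_norm_sub_tendsto_zero]
      refine squeeze_zero' (Eventually.of_forall fun n => norm_nonneg _) ?_
        (tendsto_one_div_atTop_nhds_zero_nat (𝕜 := ℝ))
      filter_upwards [eventually_ge_atTop 1] with n hn
      have hn0 : (0 : ℝ) < n := by exact_mod_cast hn
      have : (r n s : ℝ) / n - s = ((r n s : ℝ) - n * s) / n := by field_simp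
      rw [this, norm_div, Real.norm_eq_abs, Real.norm_eq_abs, abs_of_pos hn0]
      gcongr
      exact (hr n s).le
    have h2 := (kap_cont Cp Cm γ s hs.1).tendsto.comp h1
    have h3 : Tendsto (fun n : ℕ => (n : ℂ) ^ (-γ) * a (r n s)) atTop (𝓝 (kap Cp Cm γ s)) := by
      refine h2.congr' ?_
      filter_upwards [eventually_ge_atTop 1, h1.eventually_ne hs.1] with n hn hne
      rw [a_eq_kap Cp Cm γ a hap ham n hn]
      · rfl
      · intro h
        simp [h] at hne
    have h4 := (h3.sub_const (kap Cp Cm γ s)).enorm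
    simpa using h4

lemma schur (G φ : ℝ → ℝ≥0∞) (hG : Measurable G) (hφ : Measurable φ) :
    ∫⁻ x, (∫⁻ y, G (x - y) * φ y ∂μ01) ^ (2 : ℝ) ∂μ01 ≤
      (∫⁻ s, G s) ^ (2 : ℝ) * ∫⁻ y, φ y ^ (2 : ℝ) ∂μ01 := by
  set A := ∫⁻ s, G s with hA
  have hGxy : Measurable fun p : ℝ × ℝ => G (p.1 - p.2) :=
    hG.comp (measurable_fst.sub measurable_snd : Measurable fun p : ℝ × ℝ => p.1 - p.2)
  have hsq : ∀ t : ℝ≥0∞, (t ^ (1 / 2 : ℝ)) ^ (2 : ℝ) = t := fun t => by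
    rw [← ENNReal.rpow_mul]; norm_num
  have h1 : ∀ x, (∫⁻ y, G (x - y) * φ y ∂μ01) ^ (2 : ℝ) ≤
      A * ∫⁻ y, G (x - y) * φ y ^ (2 : ℝ) ∂μ01 := by
    intro x
    have hGx : Measurable fun y => G (x - y) := hG.comp (measurable_const.sub measurable_id)
    have hh := ENNReal.lintegral_mul_le_Lp_mul_Lq μ01 (p := 2) (q := 2)
      (Real.HolderConjugate.two_two)
      (f := fun y => G (x - y) ^ (1 / 2 : ℝ)) (g := fun y => G (x - y) ^ (1 / 2 : ℝ) * φ y)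
      (hGx.pow_const _).aemeasurable ((hGx.pow_const _).mul hφ).aemeasurable
    have e1 : ∀ y, ((fun y => G (x - y) ^ (1 / 2 : ℝ)) *
        (fun y => G (x - y) ^ (1 / 2 : ℝ) * φ y)) y = G (x - y) * φ y := by
      intro y
      simp only [Pi.mul_apply]
      rw [← mul_assoc, ← ENNReal.rpow_add_of_nonneg _ _ (by norm_num) (by norm_num)]
      norm_num
    have e2 : ∀ y, (G (x - y) ^ (1 / 2 : ℝ) * φ y) ^ (2 : ℝ) = G (x - y) * φ y ^ (2 : ℝ) := by
      intro y
      rw [ENNReal.mul_rpow_of_nonneg _ _ (by norm_num), hsq]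
    simp only [e1, e2, hsq] at hh
    have := ENNReal.rpow_le_rpow hh (z := 2) (by norm_num)
    rw [ENNReal.mul_rpow_of_nonneg _ _ (by norm_num), hsq, hsq] at this
    refine this.trans ?_
    gcongr
    calc ∫⁻ y, G (x - y) ∂μ01 ≤ ∫⁻ y, G (x - y) := lintegral_mono' Measure.restrict_le_self le_rfl
      _ = A := lintegral_sub_left_eq_self G x
  calc _ ≤ ∫⁻ x, A * ∫⁻ y, G (x - y) * φ y ^ (2 : ℝ) ∂μ01 ∂μ01 := lintegral_mono h1
    _ = A * ∫⁻ x, ∫⁻ y, G (x - y) * φ y ^ (2 : ℝ) ∂μ01 ∂μ01 := by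
        rw [lintegral_const_mul]
        exact Measurable.lintegral_prod_right'
          (f := fun p : ℝ × ℝ => G (p.1 - p.2) * φ p.2 ^ (2 : ℝ))
          (hGxy.mul ((hφ.comp measurable_snd).pow_const _))
    _ = A * ∫⁻ y, ∫⁻ x, G (x - y) * φ y ^ (2 : ℝ) ∂μ01 ∂μ01 := by
        rw [lintegral_lintegral_swap]
        exact (hGxy.mul ((hφ.comp measurable_snd).pow_const _)).aemeasurable
    _ ≤ A * ∫⁻ y, A * φ y ^ (2 : ℝ) ∂μ01 := by
        gcongr with y
        have hGy : Measurable fun x => G (x - y) := hG.comp (measurable_id.sub measurable_const)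
        rw [lintegral_mul_const _ hGy]
        gcongr
        calc ∫⁻ x, G (x - y) ∂μ01 ≤ ∫⁻ x, G (x - y) :=
              lintegral_mono' Measure.restrict_le_self le_rfl
          _ = A := lintegral_sub_right_eq_self G y
    _ = _ := by
        rw [lintegral_const_mul _ (hφ.pow_const _), ← mul_assoc, ENNReal.rpow_two, sq]

lemma schur_fin (G : ℝ → ℝ≥0∞) (hG : Measurable G) (hfin : ∫⁻ s, G s ≠ ∞) (f : L2I) :
    ∀ᵐ x ∂μ01, ∫⁻ y, G (x - y) * ‖(f : ℝ → ℂ) y‖ₑ ∂μ01 < ∞ := by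
  have hf : Measurable fun y => ‖(f : ℝ → ℂ) y‖ₑ := (Lp.stronglyMeasurable f).measurable.enorm
  have h := schur G _ hG hf
  have h2 : ∫⁻ y, ‖(f : ℝ → ℂ) y‖ₑ ^ (2 : ℝ) ∂μ01 < ∞ := by
    have := lintegral_rpow_enorm_lt_top_of_eLpNorm_lt_top (p := 2) (by norm_num) (by norm_num)
      (Lp.eLpNorm_lt_top f)
    simpa using this
  have h3 := h.trans_lt (ENNReal.mul_lt_top (ENNReal.rpow_lt_top_of_nonneg (by norm_num) hfin) h2)
  have hm : Measurable fun x => ∫⁻ y, G (x - y) * ‖(f : ℝ → ℂ) y‖ₑ ∂μ01 :=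
    Measurable.lintegral_prod_right'
      (f := fun p : ℝ × ℝ => G (p.1 - p.2) * ‖(f : ℝ → ℂ) p.2‖ₑ)
      ((hG.comp (measurable_fst.sub measurable_snd : Measurable fun p : ℝ × ℝ => p.1 - p.2)).mul (hf.comp measurable_snd))
  filter_upwards [ae_lt_top (hm.pow_const (2 : ℝ)) h3.ne] with x hx
  by_contra hcon
  rw [not_lt, top_le_iff] at hcon
  rw [hcon] at hx
  simp at hx

/-- Norm bound for the difference of two integral operators. -/
lemma norm_bound (k1 k2 : ℝ → ℝ → ℂ) (K1 K2 : L2I →L[ℂ] L2I)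
    (h1 : IsIntegralOp k1 K1) (h2 : IsIntegralOp k2 K2)
    (m1 : ∀ x, Measurable (k1 x)) (m2 : ∀ x, Measurable (k2 x))
    (G G2 : ℝ → ℝ≥0∞) (hG : Measurable G) (hG2 : Measurable G2)
    (hfin : ∫⁻ s, G s ≠ ∞) (hfin2 : ∫⁻ s, G2 s ≠ ∞)
    (b : ∀ x ∈ Ioo (0 : ℝ) 1, ∀ y ∈ Ioo (0 : ℝ) 1, ‖k1 x y - k2 x y‖ₑ ≤ G (x - y))
    (b2 : ∀ x ∈ Ioo (0 : ℝ) 1, ∀ y ∈ Ioo (0 : ℝ) 1, ‖k2 x y‖ₑ ≤ G2 (x - y)) :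
    ‖K1 - K2‖ ≤ (∫⁻ s, G s).toReal := by
  refine ContinuousLinearMap.opNorm_le_bound _ ENNReal.toReal_nonneg fun f => ?_
  have hf : Measurable (f : ℝ → ℂ) := (Lp.stronglyMeasurable f).measurable
  have hpt : ∀ᵐ x ∂μ01, ‖((K1 - K2) f : L2I) x‖ₑ ≤
      ∫⁻ y, G (x - y) * ‖(f : ℝ → ℂ) y‖ₑ ∂μ01 := by
    filter_upwards [h1 f, h2 f, schur_fin G hG hfin f, schur_fin G2 hG2 hfin2 f,
      Lp.coeFn_sub (K1 f) (K2 f), ae_restrict_mem measurableSet_Ioo] with x e1 e2 f1 f2 e3 hx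
    have mono1 : ∫⁻ y, ‖(k1 x y - k2 x y) * (f : ℝ → ℂ) y‖ₑ ∂μ01 ≤
        ∫⁻ y, G (x - y) * ‖(f : ℝ → ℂ) y‖ₑ ∂μ01 := by
      refine setLIntegral_mono' measurableSet_Ioo fun y hy => ?_
      rw [enorm_mul]
      gcongr
      exact b x hx y hy
    have mono2 : ∫⁻ y, ‖k2 x y * (f : ℝ → ℂ) y‖ₑ ∂μ01 ≤
        ∫⁻ y, G2 (x - y) * ‖(f : ℝ → ℂ) y‖ₑ ∂μ01 := by
      refine setLIntegral_mono' measurableSet_Ioo fun y hy => ?_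
      rw [enorm_mul]
      gcongr
      exact b2 x hx y hy
    have i1 : Integrable (fun y => (k1 x y - k2 x y) * (f : ℝ → ℂ) y) μ01 :=
      ⟨(((m1 x).sub (m2 x)).mul hf).aestronglyMeasurable, mono1.trans_lt f1⟩
    have i2 : Integrable (fun y => k2 x y * (f : ℝ → ℂ) y) μ01 :=
      ⟨((m2 x).mul hf).aestronglyMeasurable, mono2.trans_lt f2⟩
    have i3 : Integrable (fun y => k1 x y * (f : ℝ → ℂ) y) μ01 := by
      refine (i1.add i2).congr (Eventually.of_forall fun y => ?_)
      simp only [Pi.add_apply]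
      ring
    have e : ((K1 - K2) f : L2I) x = ∫ y, (k1 x y - k2 x y) * (f : ℝ → ℂ) y ∂μ01 := by
      rw [ContinuousLinearMap.sub_apply, e3, Pi.sub_apply, e1, e2, ← integral_sub i3 i2]
      congr 1
      funext y
      ring
    rw [e]
    exact (enorm_integral_le_lintegral_enorm _).trans mono1
  have hh : eLpNorm ((K1 - K2) f : L2I) 2 μ01 ≤ (∫⁻ s, G s) * eLpNorm (f : ℝ → ℂ) 2 μ01 := by
    rw [eLpNorm_eq_lintegral_rpow_enorm_toReal (by norm_num) (by norm_num),
      eLpNorm_eq_lintegral_rpow_enorm_toReal (by norm_num) (by norm_num)]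
    simp only [ENNReal.toReal_ofNat]
    have hs := schur G (fun y => ‖(f : ℝ → ℂ) y‖ₑ) hG hf.enorm
    have hs2 : ∫⁻ x, ‖((K1 - K2) f : L2I) x‖ₑ ^ (2 : ℝ) ∂μ01 ≤ _ :=
      (lintegral_mono_ae (hpt.mono fun x hx =>
        ENNReal.rpow_le_rpow hx (by norm_num : (0 : ℝ) ≤ 2))).trans hs
    refine (ENNReal.rpow_le_rpow hs2 (by norm_num : (0 : ℝ) ≤ 1 / 2)).trans ?_
    rw [ENNReal.mul_rpow_of_nonneg _ _ (by norm_num), ← ENNReal.rpow_mul]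
    norm_num
  rw [Lp.norm_def, Lp.norm_def, ← ENNReal.toReal_mul]
  exact ENNReal.toReal_mono (ENNReal.mul_ne_top hfin (Lp.eLpNorm_ne_top f)) hh

lemma kap_int (Cp Cm γ : ℂ) (hγ : -1 < γ.re) :
    ∫⁻ s in Ioo (-1 : ℝ) 1, ‖kap Cp Cm γ s‖ₑ ≠ ∞ := by
  have hi := (integrable_abs_rpow γ.re hγ).const_mul (‖Cp‖ + ‖Cm‖)
  refine (lt_of_le_of_lt ?_ hi.lintegral_lt_top).ne
  refine lintegral_mono_ae ?_
  filter_upwards [ae_restrict_of_ae (Measure.ae_ne volume (0 : ℝ))] with s h2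
  rw [← ofReal_norm]
  exact ENNReal.ofReal_le_ofReal (kap_norm Cp Cm γ s h2)

lemma floor_cases (u v : ℝ) : ⌊u⌋ - ⌊v⌋ = ⌊u - v⌋ ∨ ⌊u⌋ - ⌊v⌋ = ⌈u - v⌉ := by
  have h1 := Int.floor_le u
  have h2 := Int.lt_floor_add_one u
  have h3 := Int.floor_le v
  have h4 := Int.lt_floor_add_one v
  rcases le_total (((⌊u⌋ - ⌊v⌋ : ℤ) : ℝ)) (u - v) with h | h
  · left
    symm
    rw [Int.floor_eq_iff]
    refine ⟨h, ?_⟩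
    push_cast
    linarith
  · right
    symm
    rw [Int.ceil_eq_iff]
    refine ⟨?_, h⟩
    push_cast
    linarith

theorem stmt5 (Cp Cm γ : ℂ) (hγ : -1 < γ.re) (a : ℤ → ℂ)
    (hap : ∀ m : ℕ, 1 ≤ m → a (m : ℤ) = Cp * (m : ℂ) ^ γ)
    (ham : ∀ m : ℕ, 1 ≤ m → a (-(m : ℤ)) = Cm * (m : ℂ) ^ γ)
    (Kn : ℕ → L2I →L[ℂ] L2I) (K : L2I →L[ℂ] L2I)
    (hKn : ∀ n : ℕ, 1 ≤ n → IsIntegralOp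
      (fun x y => (n : ℂ) ^ (-γ) * a (⌊(n : ℝ) * x⌋ - ⌊(n : ℝ) * y⌋)) (Kn n))
    (hK : IsIntegralOp (fun x y =>
      if y < x then Cp * ((x - y : ℝ) : ℂ) ^ γ
      else if x < y then Cm * ((y - x : ℝ) : ℂ) ^ γ else 0) K) :
    Tendsto (fun n : ℕ => ‖Kn n - K‖) atTop (nhds 0) := by
  have hl := tendsto_aux Cp Cm γ hγ a hap ham (fun n s => ⌊(n : ℝ) * s⌋)
    (fun n s => by
      have h1 := Int.floor_le ((n : ℝ) * s)
      have h2 := Int.lt_floor_add_one ((n : ℝ) * s)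
      rw [abs_lt]; constructor <;> linarith)
    (fun n => (measurable_const.mul measurable_id).floor)
  have hu := tendsto_aux Cp Cm γ hγ a hap ham (fun n s => ⌈(n : ℝ) * s⌉)
    (fun n s => by
      have h1 := Int.le_ceil ((n : ℝ) * s)
      have h2 := Int.ceil_lt_add_one ((n : ℝ) * s)
      rw [abs_lt]; constructor <;> linarith)
    (fun n => (measurable_const.mul measurable_id).ceil)
  let gl : ℕ → ℝ → ENNReal := fun n s => ‖(n : ℂ) ^ (-γ) * a ⌊(n : ℝ) * s⌋ - kap Cp Cm γ s‖ₑ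
  let gu : ℕ → ℝ → ENNReal := fun n s => ‖(n : ℂ) ^ (-γ) * a ⌈(n : ℝ) * s⌉ - kap Cp Cm γ s‖ₑ
  have mgl : ∀ n, Measurable (gl n) := fun n =>
    ((measurable_const.mul ((measurable_from_top (f := a)).comp
      (measurable_const.mul measurable_id).floor)).sub (kap_measurable Cp Cm γ)).enorm
  have mgu : ∀ n, Measurable (gu n) := fun n =>
    ((measurable_const.mul ((measurable_from_top (f := a)).comp
      (measurable_const.mul measurable_id).ceil)).sub (kap_measurable Cp Cm γ)).enorm
  let G : ℕ → ℝ → ENNReal := fun n => (Ioo (-1 : ℝ) 1).indicator (fun s => gl n s + gu n s)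
  have hGt : Tendsto (fun n => ∫⁻ s, G n s) atTop (nhds 0) := by
    have h := hl.add hu
    rw [add_zero] at h
    refine h.congr fun n => ?_
    rw [lintegral_indicator measurableSet_Ioo]
    exact (lintegral_add_left (mgl n) _).symm
  have hGr : Tendsto (fun n => (∫⁻ s, G n s).toReal) atTop (nhds 0) := by
    have := (ENNReal.tendsto_toReal ENNReal.zero_ne_top).comp hGt
    simpa [Function.comp_def] using this
  refine squeeze_zero' (Eventually.of_forall fun n => norm_nonneg _) ?_ hGr
  filter_upwards [eventually_ge_atTop 1,
    hGt.eventually_lt_const (ENNReal.zero_lt_top)] with n hn hfin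
  have hmem : ∀ x ∈ Ioo (0 : ℝ) 1, ∀ y ∈ Ioo (0 : ℝ) 1, x - y ∈ Ioo (-1 : ℝ) 1 := by
    intro x hx y hy
    constructor <;> linarith [hx.1, hx.2, hy.1, hy.2]
  have hkeq : (fun x y : ℝ => if y < x then Cp * ((x - y : ℝ) : ℂ) ^ γ
      else if x < y then Cm * ((y - x : ℝ) : ℂ) ^ γ else 0) =
      fun x y => kap Cp Cm γ (x - y) := by
    funext x y
    simp only [kap, sub_pos, sub_neg, neg_sub]
  rw [hkeq] at hK
  refine norm_bound _ _ (Kn n) K (hKn n hn) hK ?_ ?_ (G n)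
    ((Ioo (-1 : ℝ) 1).indicator (fun s => ‖kap Cp Cm γ s‖ₑ)) ?_ ?_ hfin.ne ?_ ?_ ?_
  · intro x
    exact measurable_const.mul ((measurable_from_top (f := a)).comp
      (measurable_const.sub (measurable_const.mul measurable_id).floor))
  · intro x
    exact (kap_measurable Cp Cm γ).comp (measurable_const.sub measurable_id)
  · exact ((mgl n).add (mgu n)).indicator measurableSet_Ioo
  · exact (kap_measurable Cp Cm γ).enorm.indicator measurableSet_Ioo
  · rw [lintegral_indicator measurableSet_Ioo]
    exact kap_int Cp Cm γ hγ
  · intro x hx y hy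
    simp only [G, indicator_of_mem (hmem x hx y hy)]
    rcases floor_cases ((n : ℝ) * x) (n * y) with h | h
    · rw [h, ← mul_sub]
      exact le_self_add
    · rw [h, ← mul_sub]
      exact le_add_self
  · intro x hx y hy
    rw [indicator_of_mem (hmem x hx y hy)]
end
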